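/- Let m ≥ 2 and let G be a rooted graph with roots x_0, x_1 such that |V(G)| = 4, λ_n(G) ≥ 3, λ_n^i(G) ≥ 4, and λ_s(G) ≥ m. Then G has no rooted immersion of D_m if and only if G has type A_m or type B_m. -/

import Mathlib

open scoped Classical

noncomputable section

namespace PaperW4

/-- A finite loopless undirected multigraph on ambient vertex type `V`:
a finite vertex set together with a multiset of (non-loop) edges supported on it. -/
structure MG (V : Type) where
  verts : Finset V
  edges : Multiset (Sym2 V)
  edge_support : ∀ e ∈ edges, ∀ v ∈ e, v ∈ verts
  loopless : ∀ e ∈ edges, ¬ e.IsDiag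

variable {V : Type} {W : Type}

/-- `δ_G(X)`: the edges of `G` with exactly one endpoint in `X`. -/
def cutEdges (G : MG V) (X : Finset V) : Multiset (Sym2 V) :=
  G.edges.filter fun e => ∃ u v, e = s(u, v) ∧ u ∈ X ∧ v ∉ X

/-- `d_G(X) = |δ_G(X)|`. -/
def dcut (G : MG V) (X : Finset V) : ℕ := (cutEdges G X).card

/-- The degree of a vertex: the number of edges incident with it. -/
def deg (G : MG V) (v : V) : ℕ := (G.edges.filter fun e => v ∈ e).card

/-- `e_G(u,v)`: the number of edges joining `u` and `v`. -/
def emult (G : MG V) (u v : V) : ℕ := G.edges.count s(u, v)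

/-- `G` is `k`-edge-connected: every edge-cut `δ(X)` with `∅ ≠ X ⊊ V(G)` has size `≥ k`. -/
def EdgeConn (G : MG V) (k : ℕ) : Prop :=
  ∀ X : Finset V, X ⊆ G.verts → X.Nonempty → X ≠ G.verts → k ≤ dcut G X

/-- `G` is internally `k`-edge-connected: every edge-cut with at least two vertices
on each side has size `≥ k`. -/
def InternallyEdgeConn (G : MG V) (k : ℕ) : Prop :=
  ∀ X : Finset V, X ⊆ G.verts → 2 ≤ X.card → 2 ≤ (G.verts \ X).card → k ≤ dcut G X

/-- Every vertex has degree three. -/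
def Cubic (G : MG V) : Prop := ∀ v ∈ G.verts, deg G v = 3

/-- The multiset of edges traversed by a walk, given as its list of vertices. -/
def walkEdges (l : List V) : Multiset (Sym2 V) :=
  (↑((l.zip l.tail).map fun p => s(p.1, p.2)) : Multiset (Sym2 V))

/-- `l` is (the vertex sequence of) a walk from `u` to `v`. -/
def IsWalk (l : List V) (u v : V) : Prop :=
  l.head? = some u ∧ l.getLast? = some v

/-- `G` is connected: any two of its vertices are joined by a trail in `G`. -/
def Connected (G : MG V) : Prop :=
  ∀ u ∈ G.verts, ∀ v ∈ G.verts,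
    ∃ l : List V, IsWalk l u v ∧ walkEdges l ≤ G.edges ∧ ∀ w ∈ l, w ∈ G.verts

/-- An immersion of the loopless multigraph with vertex type `W` and edge multiset `H`
into `G`, with terminal map `φ`: `φ` is injective, and to each edge `uv` of `H` is
assigned a walk in `G` from `φ u` to `φ v`, these walks being globally edge-disjoint. -/
def ImmersionVia (G : MG V) (H : Multiset (Sym2 W)) (φ : W → V) : Prop :=
  Function.Injective φ ∧ (∀ w : W, φ w ∈ G.verts) ∧
  ∃ P : Multiset (Sym2 W × List V),
    P.map Prod.fst = H ∧
    (∀ p ∈ P, ∃ u v : W, p.1 = s(u, v) ∧ IsWalk p.2 (φ u) (φ v)) ∧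
    (P.map fun p => walkEdges p.2).sum ≤ G.edges

/-- The edges of the wheel `W₄`: vertex `0` is the center, `1,2,3,4` the rim cycle. -/
def w4Edges : Multiset (Sym2 (Fin 5)) :=
  {s(0, 1), s(0, 2), s(0, 3), s(0, 4), s(1, 2), s(2, 3), s(3, 4), s(4, 1)}

/-- `G` has an immersion of `W₄`. -/
def HasW4Immersion (G : MG V) : Prop :=
  ∃ φ : Fin 5 → V, ImmersionVia G w4Edges φ

/-- `G` (rooted at `x`) has a rooted immersion of `W₄`: one in which the
center of `W₄` corresponds to `x`. -/
def HasRootedW4Immersion (G : MG V) (x : V) : Prop :=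
  ∃ φ : Fin 5 → V, φ 0 = x ∧ ImmersionVia G w4Edges φ

/-- The edges of `D_m`: roots are `0, 1`; vertices `2, 3` play the role of `y₀, y₁`;
there are `m - 2` parallel edges between the two roots. -/
def dmEdges (m : ℕ) : Multiset (Sym2 (Fin 4)) :=
  Multiset.replicate (m - 2) s(0, 1) + {s(0, 2), s(0, 3), s(1, 2), s(1, 3), s(2, 3)}

/-- `G` with roots `x0, x1` has a rooted immersion of `D_m`. -/
def HasRootedDmImmersion (G : MG V) (m : ℕ) (x0 x1 : V) : Prop :=
  ∃ φ : Fin 4 → V, φ 0 = x0 ∧ φ 1 = x1 ∧ ImmersionVia G (dmEdges m) φ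

/-- The edges of `K₄`. -/
def k4Edges : Multiset (Sym2 (Fin 4)) :=
  {s(0, 1), s(0, 2), s(0, 3), s(1, 2), s(1, 3), s(2, 3)}

/-- A nested chain of vertex sets `C 0 ⊂ C 1 ⊂ ⋯`, each obtained from the previous
by adding one vertex, all cuts having size exactly `k`. -/
def SegChain (G : MG V) (n : ℕ) (C : Fin (n + 1) → Finset V) (k : ℕ) : Prop :=
  (∀ i, C i ⊆ G.verts) ∧
  (∀ i : Fin n, C i.castSucc ⊆ C i.succ ∧ (C i.succ \ C i.castSucc).card = 1) ∧
  (∀ i, dcut G (C i) = k)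

/-- `G` has a segmentation of width `k` relative to `(X, Y)`. -/
def HasSegmentation (G : MG V) (X Y : Finset V) (k : ℕ) : Prop :=
  ∃ (n : ℕ) (C : Fin (n + 1) → Finset V),
    SegChain G n C k ∧ C 0 = X ∧ G.verts \ C (Fin.last n) = Y

/-- `λ_s(G) ≥ m`: every edge-cut separating `x0` from `x1` has size `≥ m`. -/
def LamSGe (G : MG V) (x0 x1 : V) (m : ℕ) : Prop :=
  ∀ X : Finset V, X ⊆ G.verts → x0 ∈ X → x1 ∉ X → m ≤ dcut G X

/-- `λ_n(G) ≥ m`: every edge-cut not separating `x0` from `x1` has size `≥ m`. -/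
def LamNGe (G : MG V) (x0 x1 : V) (m : ℕ) : Prop :=
  ∀ X : Finset V, X ⊆ G.verts → X.Nonempty → X ≠ G.verts →
    (x0 ∈ X ↔ x1 ∈ X) → m ≤ dcut G X

/-- `λ_n^i(G) ≥ m`: every internal edge-cut not separating `x0` from `x1` has size `≥ m`. -/
def LamNiGe (G : MG V) (x0 x1 : V) (m : ℕ) : Prop :=
  ∀ X : Finset V, X ⊆ G.verts → 2 ≤ X.card → 2 ≤ (G.verts \ X).card →
    (x0 ∈ X ↔ x1 ∈ X) → m ≤ dcut G X

/-- The subgraph of `G` induced on `S`. -/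
def induce (G : MG V) (S : Finset V) : MG V where
  verts := G.verts ∩ S
  edges := G.edges.filter fun e => ∀ v ∈ e, v ∈ S
  edge_support := by
    intro e he v hv
    rw [Multiset.mem_filter] at he
    exact Finset.mem_inter.mpr ⟨G.edge_support e he.1 v hv, he.2 v hv⟩
  loopless := fun e he => G.loopless e (Multiset.mem_of_mem_filter he)

/-- `G` with the vertices of `S` (and all incident edges) deleted. -/
def deleteVerts (G : MG V) (S : Finset V) : MG V := induce G (G.verts \ S)

/-- `C` is (the vertex set of) a connected component of `G`. -/
def IsComponent (G : MG V) (C : Finset V) : Prop :=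
  C ⊆ G.verts ∧ C.Nonempty ∧ Connected (induce G C) ∧
  ∀ e ∈ G.edges, (∃ v ∈ e, v ∈ C) → ∀ v ∈ e, v ∈ C

/-- `G` has type `A_m` with respect to roots `x0, x1`. -/
def TypeA (G : MG V) (m : ℕ) (x0 x1 : V) : Prop :=
  ∃ X0 X1 : Finset V, x0 ∈ X0 ∧ x1 ∈ X1 ∧ X0.card ≤ 2 ∧ X1.card ≤ 2 ∧
    HasSegmentation G X0 X1 m

/-- The edges of the lobe of `G` (with roots `x0, x1`) corresponding to the
component `C` of `G ∖ {x0, x1}`: edges inside `C ∪ {x0, x1}` other than `x0x1`-edges. -/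
def lobeEdges (G : MG V) (C : Finset V) (x0 x1 : V) : Multiset (Sym2 V) :=
  G.edges.filter fun e => (∀ v ∈ e, v ∈ insert x0 (insert x1 C)) ∧ e ≠ s(x0, x1)

/-- `G` has type `B_m` with respect to roots `x0, x1`. -/
def TypeB (G : MG V) (m : ℕ) (x0 x1 : V) : Prop :=
  ∃ (k : ℕ) (C : Fin k → Finset V) (nL : Fin k → ℕ),
    Function.Injective C ∧
    (∀ D : Finset V, IsComponent (deleteVerts G {x0, x1}) D ↔ ∃ i, C i = D) ∧
    (∀ i : Fin k, 2 ≤ nL i ∧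
      ∃ l : List V, l.Nodup ∧ IsWalk l x0 x1 ∧
        l.toFinset = insert x0 (insert x1 (C i)) ∧
        (2 ≤ (C i).card → nL i = 2) ∧
        lobeEdges G (C i) x0 x1 = nL i • walkEdges l) ∧
    emult G x0 x1 + ∑ i, nL i = m + 1

/-- The edge multiset of a cycle of length `n` on the vertices `f 0, f 1, …`. -/
def cycleEdges (n : ℕ) (f : Fin n → V) : Multiset (Sym2 V) :=
  (Finset.univ.val : Multiset (Fin n)).map fun i =>
    s(f i, f ⟨(i.val + 1) % n, Nat.mod_lt _ i.pos⟩)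

/-- `G` is a doubled cycle of length `n`. -/
def IsDoubledCycleLen (G : MG V) (n : ℕ) : Prop :=
  ∃ f : Fin n → V, Function.Injective f ∧ Finset.univ.image f = G.verts ∧
    G.edges = 2 • cycleEdges n f

/-- `G` is a doubled cycle. -/
def IsDoubledCycle (G : MG V) : Prop := ∃ n, 3 ≤ n ∧ IsDoubledCycleLen G n

/-- The map collapsing all of `Y` to the vertex `y0` and fixing everything else. -/
def collapseFun (Y : Finset V) (y0 : V) : V → V := fun v => if v ∈ Y then y0 else v

/-- The image multigraph of `G` under a vertex map `f` (identification of vertices),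
with any created loops deleted. -/
def mapGraph (f : V → V) (G : MG V) : MG V where
  verts := G.verts.image f
  edges := (G.edges.map (Sym2.map f)).filter fun e => ¬e.IsDiag
  edge_support := by
    intro e he v hv
    rw [Multiset.mem_filter] at he
    obtain ⟨he, -⟩ := he
    rw [Multiset.mem_map] at he
    obtain ⟨e', he', rfl⟩ := he
    rw [Sym2.mem_map] at hv
    obtain ⟨u, hu, rfl⟩ := hv
    exact Finset.mem_image_of_mem f (G.edge_support e' he' u hu)
  loopless := by
    intro e he
    rw [Multiset.mem_filter] at he
    exact he.2

/-- `G[X]` is a chain of sausages of order `k` in `G`: identifying `V(G) ∖ X` to a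
single vertex yields a doubled cycle of length `k + 1`. -/
def ChainOfSausages (G : MG V) (X : Finset V) (k : ℕ) : Prop :=
  X ⊆ G.verts ∧ X.card = k ∧ 2 ≤ k ∧
  ∃ y0 ∈ G.verts \ X,
    IsDoubledCycleLen (mapGraph (collapseFun (G.verts \ X) y0) G) (k + 1)

/-- `G` is sausage reduced: it has no chain of sausages of order at least `3`. -/
def SausageReduced (G : MG V) : Prop :=
  ¬ ∃ (X : Finset V) (k : ℕ), 3 ≤ k ∧ ChainOfSausages G X k

/-- One sausage shortening step of a rooted graph: two adjacent vertices of a chain of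
sausages of order at least three are identified, carrying the root along. -/
def RootedShortStep (p q : MG V × V) : Prop :=
  ∃ (X : Finset V) (k : ℕ) (a b : V),
    3 ≤ k ∧ ChainOfSausages p.1 X k ∧ a ∈ X ∧ b ∈ X ∧ a ≠ b ∧ s(a, b) ∈ p.1.edges ∧
    q.1 = mapGraph (fun v => if v = b then a else v) p.1 ∧
    q.2 = (if p.2 = b then a else p.2)

/-- Deleting a single copy of the edge `e` from `G`. -/
def deleteEdge (G : MG V) (e : Sym2 V) : MG V where
  verts := G.verts
  edges := G.edges.erase e
  edge_support := fun e' he' => G.edge_support e' (Multiset.mem_of_mem_erase he')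
  loopless := fun e' he' => G.loopless e' (Multiset.mem_of_mem_erase he')

/-- `G` has a tree-decomposition of width at most `k`. -/
def HasTreeDecomp (G : MG V) (k : ℕ) : Prop :=
  ∃ (ι : Type) (T : SimpleGraph ι) (B : ι → Finset V),
    T.IsTree ∧
    (∀ t, B t ⊆ G.verts) ∧
    (∀ v ∈ G.verts, ∃ t, v ∈ B t) ∧
    (∀ e ∈ G.edges, ∃ t, ∀ v ∈ e, v ∈ B t) ∧
    (∀ v ∈ G.verts, (SimpleGraph.induce {t | v ∈ B t} T).Connected) ∧
    ∀ t, (B t).card ≤ k + 1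

/-- The tree-width of `G`. -/
def treewidth (G : MG V) : ℕ := sInf { k | HasTreeDecomp G k }

/-- One subdivision step: an edge `uv` is replaced by a path `u - w - v`
through a new vertex `w`. -/
def SubdivStep (G H : MG V) : Prop :=
  ∃ u v w : V, s(u, v) ∈ G.edges ∧ w ∉ G.verts ∧
    H.verts = insert w G.verts ∧
    H.edges = (G.edges.erase s(u, v)) + {s(u, w), s(w, v)}

/-- `H` is a subdivision of `G`. -/
def IsSubdivision (G H : MG V) : Prop := Relation.ReflTransGen SubdivStep G H

/-- `G`, rooted at `u`, has type 2 (for the rooted `W₄` theorem). -/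
def TypeTwo (G : MG V) (u : V) : Prop :=
  ∃ W0 : Finset V, W0 ⊆ G.verts ∧ u ∉ W0 ∧ 1 ≤ W0.card ∧ W0.card ≤ 2 ∧
    ∃ w0 ∈ W0,
      ∃ n : ℕ, 3 ≤ n ∧
        ∃ f : Fin n → V,
          Function.Injective f ∧
          Finset.univ.image f = (mapGraph (collapseFun W0 w0) G).verts ∧
          (∃ i, f i = u) ∧ (∃ j, f j = w0) ∧
          ((s(u, w0) ∉ cycleEdges n f ∧
              (mapGraph (collapseFun W0 w0) G).edges =
                2 • cycleEdges n f + {s(u, w0)}) ∨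
           (∃ v : V, s(u, v) ∈ cycleEdges n f ∧ s(v, w0) ∈ cycleEdges n f ∧
              (mapGraph (collapseFun W0 w0) G).edges =
                2 • cycleEdges n f + {s(u, v), s(v, w0)}) ∨
           (s(u, w0) ∈ cycleEdges n f ∧
              (mapGraph (collapseFun W0 w0) G).edges =
                2 • cycleEdges n f + {s(u, w0)}))

/-- The data of an immersion with edge multisets only: `H` is routed in `E` along `φ`. -/
def Routes {α β : Type} (H : Multiset (Sym2 α)) (E : Multiset (Sym2 β)) (φ : α → β) : Prop :=
  ∃ P : Multiset (Sym2 α × List β),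
    P.map Prod.fst = H ∧
    (∀ p ∈ P, ∃ u v : α, p.1 = s(u, v) ∧ IsWalk p.2 (φ u) (φ v)) ∧
    (P.map fun p => walkEdges p.2).sum ≤ E

lemma walkEdges_map {α β : Type} (f : α → β) (l : List α) :
    walkEdges (l.map f) = (walkEdges l).map (Sym2.map f) := by
  simp only [walkEdges, ← List.map_tail, List.zip_map, List.map_map, Multiset.map_coe]
  congr 1

lemma IsWalk.map {α β : Type} (f : α → β) {l : List α} {u v : α} (h : IsWalk l u v) :
    IsWalk (l.map f) (f u) (f v) := by
  obtain ⟨h1, h2⟩ := h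
  simp [IsWalk, List.head?_map, List.getLast?_map, h1, h2]

lemma Routes.map {α α' β β' : Type} {H : Multiset (Sym2 α)} {E : Multiset (Sym2 β)} {φ : α → β}
    (h : Routes H E φ) (σ : α → α') (τ : β → β') (φ' : α' → β') (hc : ∀ x, φ' (σ x) = τ (φ x)) :
    Routes (H.map (Sym2.map σ)) (E.map (Sym2.map τ)) φ' := by
  obtain ⟨P, rfl, h2, h3⟩ := h
  refine ⟨P.map (Prod.map (Sym2.map σ) (List.map τ)), ?_, ?_, ?_⟩
  · simp [Multiset.map_map]
  · intro p hp
    obtain ⟨p', hp', rfl⟩ := Multiset.mem_map.1 hp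
    obtain ⟨u, v, h4, h5⟩ := h2 p' hp'
    refine ⟨σ u, σ v, by simp [h4], ?_⟩
    rw [hc, hc]
    exact h5.map τ
  · refine le_trans (le_of_eq ?_) (Multiset.map_le_map h3)
    have := map_multiset_sum (Multiset.mapAddMonoidHom (Sym2.map τ))
      (P.map fun p => walkEdges p.2)
    simp only [Multiset.coe_mapAddMonoidHom] at this
    rw [this]
    simp [Multiset.map_map, walkEdges_map]

/-- The edge multiset on four vertices with prescribed multiplicities. The roots are `0, 1`. -/
def k4Mult (a b c d p q : ℕ) : Multiset (Sym2 (Fin 4)) :=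
  .replicate a s(0, 2) + .replicate b s(0, 3) + .replicate c s(1, 2) + .replicate d s(1, 3) +
    .replicate p s(2, 3) + .replicate q s(0, 1)

lemma k4Mult_add (a b c d p q a' b' c' d' p' q' : ℕ) :
    k4Mult a b c d p q + k4Mult a' b' c' d' p' q' =
      k4Mult (a + a') (b + b') (c + c') (d + d') (p + p') (q + q') := by
  simp only [k4Mult, Multiset.replicate_add]
  abel

lemma k4Mult_mono {a b c d p q a' b' c' d' p' q' : ℕ} (ha : a ≤ a') (hb : b ≤ b') (hc : c ≤ c')
    (hd : d ≤ d') (hp : p ≤ p') (hq : q ≤ q') :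
    k4Mult a b c d p q ≤ k4Mult a' b' c' d' p' q' := by
  have := k4Mult_add a b c d p q (a' - a) (b' - b) (c' - c) (d' - d) (p' - p) (q' - q)
  simp only [Nat.add_sub_cancel' ha, Nat.add_sub_cancel' hb, Nat.add_sub_cancel' hc,
    Nat.add_sub_cancel' hd, Nat.add_sub_cancel' hp, Nat.add_sub_cancel' hq] at this
  rw [← this]
  exact Multiset.le_add_right _ _

lemma nsmul_k4Mult (n a b c d p q : ℕ) :
    n • k4Mult a b c d p q = k4Mult (n * a) (n * b) (n * c) (n * d) (n * p) (n * q) := by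
  simp [k4Mult, Multiset.nsmul_replicate]

/-- Menger's theorem for two roots in a multigraph on four vertices. -/
lemma exists_root_paths (a b c d p q k : ℕ) (h0 : k ≤ a + b + q) (h1 : k ≤ c + d + q)
    (h2 : k ≤ b + c + p + q) (h3 : k ≤ a + d + p + q) :
    ∃ t t₂ t₃ t₂₃ t₃₂ : ℕ, t + t₂ + t₃ + t₂₃ + t₃₂ = k ∧ t₂ + t₂₃ ≤ a ∧ t₃ + t₃₂ ≤ b ∧
      t₂ + t₃₂ ≤ c ∧ t₃ + t₂₃ ≤ d ∧ t₂₃ + t₃₂ ≤ p ∧ t ≤ q := by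
  suffices h : ∃ t t₂ t₃ t₂₃ t₃₂ : ℕ, k ≤ t + t₂ + t₃ + t₂₃ + t₃₂ ∧ t₂ + t₂₃ ≤ a ∧
      t₃ + t₃₂ ≤ b ∧ t₂ + t₃₂ ≤ c ∧ t₃ + t₂₃ ≤ d ∧ t₂₃ + t₃₂ ≤ p ∧ t ≤ q by
    obtain ⟨t, t₂, t₃, t₂₃, t₃₂, h⟩ := h
    refine ⟨min t k, min t₂ (k - t), min t₃ (k - t - t₂), min t₂₃ (k - t - t₂ - t₃),
      min t₃₂ (k - t - t₂ - t₃ - t₂₃), ?_⟩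
    omega
  refine ⟨q, min a c, min b d, min (min (a - c) (d - b)) p, min (min (c - a) (b - d)) p, ?_⟩
  omega

lemma routes_of_walks {w₀₂ w₀₃ w₁₂ w₁₃ w₂₃ : List (Fin 4)} (e₀ e₁ e₂ e₃ e₄ e₅ : ℕ)
    (hw : IsWalk w₀₂ 0 2 ∧ IsWalk w₀₃ 0 3 ∧ IsWalk w₁₂ 1 2 ∧ IsWalk w₁₃ 1 3 ∧ IsWalk w₂₃ 2 3)
    (he : walkEdges w₀₂ + (walkEdges w₀₃ + (walkEdges w₁₂ + (walkEdges w₁₃ + walkEdges w₂₃))) =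
      k4Mult e₀ e₁ e₂ e₃ e₄ e₅)
    {a b c d p q m : ℕ} (ha : e₀ ≤ a ∧ e₁ ≤ b ∧ e₂ ≤ c ∧ e₃ ≤ d ∧ e₄ ≤ p ∧ e₅ ≤ q ∧
      m + (e₀ + e₁ + e₅) ≤ a + b + q + 2 ∧ m + (e₂ + e₃ + e₅) ≤ c + d + q + 2 ∧
      m + (e₁ + e₂ + e₄ + e₅) ≤ b + c + p + q + 2 ∧
      m + (e₀ + e₃ + e₄ + e₅) ≤ a + d + p + q + 2) :
    Routes (dmEdges m) (k4Mult a b c d p q) id := by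
  obtain ⟨ha, hb, hc, hd, hp, hq, h0, h1, h2, h3⟩ := ha
  obtain ⟨t, t₂, t₃, t₂₃, t₃₂, hk, ka, kb, kc, kd, kp, kq⟩ :=
    exists_root_paths (a - e₀) (b - e₁) (c - e₂) (d - e₃) (p - e₄) (q - e₅) (m - 2)
      (by omega) (by omega) (by omega) (by omega)
  refine ⟨.replicate t (s(0, 1), [0, 1]) + .replicate t₂ (s(0, 1), [0, 2, 1]) +
    .replicate t₃ (s(0, 1), [0, 3, 1]) + .replicate t₂₃ (s(0, 1), [0, 2, 3, 1]) +
    .replicate t₃₂ (s(0, 1), [0, 3, 2, 1]) +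
    {(s(0, 2), w₀₂), (s(0, 3), w₀₃), (s(1, 2), w₁₂), (s(1, 3), w₁₃), (s(2, 3), w₂₃)}, ?_, ?_, ?_⟩
  · simp only [Multiset.map_add, Multiset.map_replicate, ← Multiset.replicate_add, hk, dmEdges]
    rfl
  · intro x hx
    simp only [Multiset.mem_add, Multiset.mem_replicate, Multiset.insert_eq_cons,
      Multiset.mem_cons, Multiset.mem_singleton] at hx
    rcases hx with (((((⟨-, rfl⟩ | ⟨-, rfl⟩) | ⟨-, rfl⟩) | ⟨-, rfl⟩) | ⟨-, rfl⟩) |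
      (rfl | rfl | rfl | rfl | rfl))
    iterate 5 exact ⟨0, 1, rfl, rfl, rfl⟩
    · exact ⟨0, 2, rfl, hw.1⟩
    · exact ⟨0, 3, rfl, hw.2.1⟩
    · exact ⟨1, 2, rfl, hw.2.2.1⟩
    · exact ⟨1, 3, rfl, hw.2.2.2.1⟩
    · exact ⟨2, 3, rfl, hw.2.2.2.2⟩
  · have e1 : walkEdges [(0 : Fin 4), 1] = k4Mult 0 0 0 0 0 1 := by decide
    have e2 : walkEdges [(0 : Fin 4), 2, 1] = k4Mult 1 0 1 0 0 0 := by decide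
    have e3 : walkEdges [(0 : Fin 4), 3, 1] = k4Mult 0 1 0 1 0 0 := by decide
    have e4 : walkEdges [(0 : Fin 4), 2, 3, 1] = k4Mult 1 0 0 1 1 0 := by decide
    have e5 : walkEdges [(0 : Fin 4), 3, 2, 1] = k4Mult 0 1 1 0 1 0 := by decide
    simp only [Multiset.map_add, Multiset.map_replicate, Multiset.sum_add,
      Multiset.sum_replicate, Multiset.insert_eq_cons, Multiset.map_cons, Multiset.map_singleton,
      Multiset.sum_cons, Multiset.sum_singleton, e1, e2, e3, e4, e5, nsmul_k4Mult]
    rw [he]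
    simp only [k4Mult_add]
    apply k4Mult_mono <;> omega

/-- The edge multiplicities of a rooted graph on four vertices satisfying the connectivity
hypotheses but having neither type `A_m` nor type `B_m`. -/
structure Admissible (a b c d p q m : ℕ) : Prop where
  two_le : 2 ≤ m
  deg₂ : 3 ≤ a + c + p
  deg₃ : 3 ≤ b + d + p
  cut₂₃ : 4 ≤ a + b + c + d
  deg₀ : m ≤ a + b + q
  deg₁ : m ≤ c + d + q
  cut₀₂ : m + 1 ≤ b + c + p + q
  cut₀₃ : m + 1 ≤ a + d + p + q
  not_two_lobes : ¬ (p = 0 ∧ a = c ∧ b = d ∧ 2 ≤ a ∧ 2 ≤ b ∧ a + b + q = m + 1)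
  not_path₂₃ : ¬ (a = 2 ∧ p = 2 ∧ d = 2 ∧ b = 0 ∧ c = 0 ∧ q + 2 = m + 1)
  not_path₃₂ : ¬ (b = 2 ∧ p = 2 ∧ c = 2 ∧ a = 0 ∧ d = 0 ∧ q + 2 = m + 1)

lemma Admissible.swap_roots {a b c d p q m : ℕ} (h : Admissible a b c d p q m) :
    Admissible c d a b p q m := by
  obtain ⟨h0, h1, h2, h3, h4, h5, h6, h7, h8, h9, h10⟩ := h
  constructor <;> omega

lemma Admissible.swap_others {a b c d p q m : ℕ} (h : Admissible a b c d p q m) :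
    Admissible b a d c p q m := by
  obtain ⟨h0, h1, h2, h3, h4, h5, h6, h7, h8, h9, h10⟩ := h
  constructor <;> omega

lemma Routes.swap_roots {a b c d p q m : ℕ} (h : Routes (dmEdges m) (k4Mult a b c d p q) id) :
    Routes (dmEdges m) (k4Mult c d a b p q) id := by
  have := h.map (Equiv.swap (0 : Fin 4) 1) (Equiv.swap (0 : Fin 4) 1) id (fun _ => rfl)
  convert this using 1
  · simp only [dmEdges, Multiset.map_add, Multiset.map_replicate]
    exact congrArg₂ _ (congrArg _ (by decide)) (by decide)
  · simp only [k4Mult, Multiset.map_add, Multiset.map_replicate]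
    rw [show Sym2.map (Equiv.swap (0 : Fin 4) 1) s(0, 2) = s(1, 2) by decide,
      show Sym2.map (Equiv.swap (0 : Fin 4) 1) s(0, 3) = s(1, 3) by decide,
      show Sym2.map (Equiv.swap (0 : Fin 4) 1) s(1, 2) = s(0, 2) by decide,
      show Sym2.map (Equiv.swap (0 : Fin 4) 1) s(1, 3) = s(0, 3) by decide,
      show Sym2.map (Equiv.swap (0 : Fin 4) 1) s(2, 3) = s(2, 3) by decide,
      show Sym2.map (Equiv.swap (0 : Fin 4) 1) s(0, 1) = s(0, 1) by decide]
    abel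

lemma Routes.swap_others {a b c d p q m : ℕ} (h : Routes (dmEdges m) (k4Mult a b c d p q) id) :
    Routes (dmEdges m) (k4Mult b a d c p q) id := by
  have := h.map (Equiv.swap (2 : Fin 4) 3) (Equiv.swap (2 : Fin 4) 3) id (fun _ => rfl)
  convert this using 1
  · simp only [dmEdges, Multiset.map_add, Multiset.map_replicate]
    exact congrArg₂ _ (congrArg _ (by decide)) (by decide)
  · simp only [k4Mult, Multiset.map_add, Multiset.map_replicate]
    rw [show Sym2.map (Equiv.swap (2 : Fin 4) 3) s(0, 2) = s(0, 3) by decide,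
      show Sym2.map (Equiv.swap (2 : Fin 4) 3) s(0, 3) = s(0, 2) by decide,
      show Sym2.map (Equiv.swap (2 : Fin 4) 3) s(1, 2) = s(1, 3) by decide,
      show Sym2.map (Equiv.swap (2 : Fin 4) 3) s(1, 3) = s(1, 2) by decide,
      show Sym2.map (Equiv.swap (2 : Fin 4) 3) s(2, 3) = s(2, 3) by decide,
      show Sym2.map (Equiv.swap (2 : Fin 4) 3) s(0, 1) = s(0, 1) by decide]
    abel

lemma Admissible.routes_support_abcdp {a b c d p q m : ℕ} (h : Admissible a b c d p q m)
    (hpos : 0 < a ∧ 0 < b ∧ 0 < c ∧ 0 < d ∧ 0 < p) :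
    Routes (dmEdges m) (k4Mult a b c d p q) id := by
  obtain ⟨h0, h1, h2, h3, h4, h5, h6, h7, h8, h9, h10⟩ := h
  by_contra hn
  have t1 : ¬ _ := fun hf => hn (routes_of_walks (w₀₂ := [0, 2]) (w₀₃ := [0, 3]) (w₁₂ := [1, 2])
    (w₁₃ := [1, 3]) (w₂₃ := [2, 3]) 1 1 1 1 1 0 (by simp [IsWalk]) (by decide) hf)
  clear hn
  omega

lemma Admissible.routes_support_abcd_of_deg {a b c d q m : ℕ} (h : Admissible a b c d 0 q m)
    (hpos : 0 < a ∧ 0 < b ∧ 0 < c ∧ 0 < d) (hs : m + 2 ≤ a + b + q) :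
    Routes (dmEdges m) (k4Mult a b c d 0 q) id := by
  obtain ⟨h0, h1, h2, h3, h4, h5, h6, h7, -, -, -⟩ := h
  by_contra hn
  have t1 := fun hf => hn (routes_of_walks (w₀₂ := [0, 2]) (w₀₃ := [0, 3]) (w₁₂ := [1, 2])
    (w₁₃ := [1, 3]) (w₂₃ := [2, 0, 3]) 2 2 1 1 0 0 (by simp [IsWalk]) (by decide) hf)
  have t2 := fun hf => hn (routes_of_walks (w₀₂ := [0, 2]) (w₀₃ := [0, 3]) (w₁₂ := [1, 2])
    (w₁₃ := [1, 3]) (w₂₃ := [2, 1, 3]) 1 1 2 2 0 0 (by simp [IsWalk]) (by decide) hf)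
  have t3 := fun hf => hn (routes_of_walks (w₀₂ := [0, 2]) (w₀₃ := [0, 3]) (w₁₂ := [1, 2])
    (w₁₃ := [1, 3]) (w₂₃ := [2, 0, 1, 3]) 2 1 1 2 0 1 (by simp [IsWalk]) (by decide) hf)
  have t4 := fun hf => hn (routes_of_walks (w₀₂ := [0, 2]) (w₀₃ := [0, 3]) (w₁₂ := [1, 2])
    (w₁₃ := [1, 3]) (w₂₃ := [2, 1, 0, 3]) 1 2 2 1 0 1 (by simp [IsWalk]) (by decide) hf)
  clear hn
  rcases (show a = 1 ∨ 2 ≤ a by omega) with ha | ha <;>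
    rcases (show b = 1 ∨ 2 ≤ b by omega) with hb | hb
  · exact t2 (by omega)
  · rcases (show d = 1 ∨ 2 ≤ d by omega) with hd | hd
    · exact t4 (by omega)
    · exact t2 (by omega)
  · rcases (show c = 1 ∨ 2 ≤ c by omega) with hc | hc
    · exact t3 (by omega)
    · exact t2 (by omega)
  · exact t1 (by omega)

lemma Admissible.routes_support_abcd {a b c d q m : ℕ} (h : Admissible a b c d 0 q m)
    (hpos : 0 < a ∧ 0 < b ∧ 0 < c ∧ 0 < d) :
    Routes (dmEdges m) (k4Mult a b c d 0 q) id := by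
  by_cases hs : m + 2 ≤ a + b + q
  · exact h.routes_support_abcd_of_deg hpos hs
  · obtain ⟨ha, hb, hc, hd⟩ := hpos
    refine (h.swap_roots.routes_support_abcd_of_deg ⟨hc, hd, ha, hb⟩ ?_).swap_roots
    obtain ⟨h0, h1, h2, h3, h4, h5, h6, h7, h8, -, -⟩ := h
    omega

lemma Admissible.routes_support_abcp {a b c p q m : ℕ} (h : Admissible a b c 0 p q m)
    (hpos : 0 < a ∧ 0 < b ∧ 0 < c ∧ 0 < p) :
    Routes (dmEdges m) (k4Mult a b c 0 p q) id := by
  obtain ⟨h0, h1, h2, h3, h4, h5, h6, h7, h8, h9, h10⟩ := h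
  by_contra hn
  have t1 : ¬ _ := fun hf => hn (routes_of_walks (w₀₂ := [0, 2]) (w₀₃ := [0, 3]) (w₁₂ := [1, 2])
    (w₁₃ := [1, 2, 3]) (w₂₃ := [2, 3]) 1 1 2 0 2 0 (by simp [IsWalk]) (by decide) hf)
  have t2 : ¬ _ := fun hf => hn (routes_of_walks (w₀₂ := [0, 2]) (w₀₃ := [0, 3]) (w₁₂ := [1, 2])
    (w₁₃ := [1, 0, 3]) (w₂₃ := [2, 3]) 1 2 1 0 1 1 (by simp [IsWalk]) (by decide) hf)
  have t3 : ¬ _ := fun hf => hn (routes_of_walks (w₀₂ := [0, 2]) (w₀₃ := [0, 3]) (w₁₂ := [1, 2])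
    (w₁₃ := [1, 0, 2, 3]) (w₂₃ := [2, 3]) 2 1 1 0 2 1 (by simp [IsWalk]) (by decide) hf)
  have t4 : ¬ _ := fun hf => hn (routes_of_walks (w₀₂ := [0, 2]) (w₀₃ := [0, 3]) (w₁₂ := [1, 2])
    (w₁₃ := [1, 2, 3]) (w₂₃ := [2, 0, 3]) 2 2 2 0 1 0 (by simp [IsWalk]) (by decide) hf)
  clear hn
  omega

lemma Admissible.routes_support_abc {a b c q m : ℕ} (h : Admissible a b c 0 0 q m)
    (hpos : 0 < a ∧ 0 < b ∧ 0 < c) :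
    Routes (dmEdges m) (k4Mult a b c 0 0 q) id := by
  obtain ⟨h0, h1, h2, h3, h4, h5, h6, h7, h8, h9, h10⟩ := h
  by_contra hn
  have t1 : ¬ _ := fun hf => hn (routes_of_walks (w₀₂ := [0, 2]) (w₀₃ := [0, 3]) (w₁₂ := [1, 2])
    (w₁₃ := [1, 0, 3]) (w₂₃ := [2, 0, 3]) 2 3 1 0 0 1 (by simp [IsWalk]) (by decide) hf)
  have t2 : ¬ _ := fun hf => hn (routes_of_walks (w₀₂ := [0, 2]) (w₀₃ := [0, 3]) (w₁₂ := [1, 2])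
    (w₁₃ := [1, 0, 3]) (w₂₃ := [2, 1, 0, 3]) 1 3 2 0 0 2 (by simp [IsWalk]) (by decide) hf)
  have t3 : ¬ _ := fun hf => hn (routes_of_walks (w₀₂ := [0, 2]) (w₀₃ := [0, 3]) (w₁₂ := [1, 2])
    (w₁₃ := [1, 2, 0, 3]) (w₂₃ := [2, 0, 3]) 3 3 2 0 0 0 (by simp [IsWalk]) (by decide) hf)
  clear hn
  omega

lemma Admissible.routes_support_abp {a b p q m : ℕ} (h : Admissible a b 0 0 p q m)
    (hpos : 0 < a ∧ 0 < b ∧ 0 < p) :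
    Routes (dmEdges m) (k4Mult a b 0 0 p q) id := by
  obtain ⟨h0, h1, h2, h3, h4, h5, h6, h7, h8, h9, h10⟩ := h
  by_contra hn
  have t1 : ¬ _ := fun hf => hn (routes_of_walks (w₀₂ := [0, 2]) (w₀₃ := [0, 3]) (w₁₂ := [1, 0, 2])
    (w₁₃ := [1, 0, 3]) (w₂₃ := [2, 3]) 2 2 0 0 1 2 (by simp [IsWalk]) (by decide) hf)
  have t2 : ¬ _ := fun hf => hn (routes_of_walks (w₀₂ := [0, 2]) (w₀₃ := [0, 3]) (w₁₂ := [1, 0, 2])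
    (w₁₃ := [1, 0, 2, 3]) (w₂₃ := [2, 3]) 3 1 0 0 2 2 (by simp [IsWalk]) (by decide) hf)
  have t3 : ¬ _ := fun hf => hn (routes_of_walks (w₀₂ := [0, 2]) (w₀₃ := [0, 3]) (w₁₂ := [1, 0, 3, 2])
    (w₁₃ := [1, 0, 3]) (w₂₃ := [2, 3]) 1 3 0 0 2 2 (by simp [IsWalk]) (by decide) hf)
  clear hn
  omega

lemma Admissible.routes_support_ab {a b q m : ℕ} (h : Admissible a b 0 0 0 q m) :
    Routes (dmEdges m) (k4Mult a b 0 0 0 q) id := by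
  obtain ⟨h0, h1, h2, h3, h4, h5, h6, h7, h8, h9, h10⟩ := h
  by_contra hn
  have t1 : ¬ _ := fun hf => hn (routes_of_walks (w₀₂ := [0, 2]) (w₀₃ := [0, 3]) (w₁₂ := [1, 0, 2])
    (w₁₃ := [1, 0, 3]) (w₂₃ := [2, 0, 3]) 3 3 0 0 0 2 (by simp [IsWalk]) (by decide) hf)
  clear hn
  omega

lemma Admissible.routes_support_acp {a c p q m : ℕ} (h : Admissible a 0 c 0 p q m)
    (hpos : 0 < a ∧ 0 < c ∧ 0 < p) :
    Routes (dmEdges m) (k4Mult a 0 c 0 p q) id := by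
  obtain ⟨h0, h1, h2, h3, h4, h5, h6, h7, h8, h9, h10⟩ := h
  by_contra hn
  have t1 : ¬ _ := fun hf => hn (routes_of_walks (w₀₂ := [0, 2]) (w₀₃ := [0, 2, 3]) (w₁₂ := [1, 2])
    (w₁₃ := [1, 2, 3]) (w₂₃ := [2, 3]) 2 0 2 0 3 0 (by simp [IsWalk]) (by decide) hf)
  have t2 : ¬ _ := fun hf => hn (routes_of_walks (w₀₂ := [0, 2]) (w₀₃ := [0, 2, 3]) (w₁₂ := [1, 2])
    (w₁₃ := [1, 0, 2, 3]) (w₂₃ := [2, 3]) 3 0 1 0 3 1 (by simp [IsWalk]) (by decide) hf)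
  have t3 : ¬ _ := fun hf => hn (routes_of_walks (w₀₂ := [0, 2]) (w₀₃ := [0, 1, 2, 3]) (w₁₂ := [1, 2])
    (w₁₃ := [1, 2, 3]) (w₂₃ := [2, 3]) 1 0 3 0 3 1 (by simp [IsWalk]) (by decide) hf)
  clear hn
  omega

lemma Admissible.routes_support_adp {a d p q m : ℕ} (h : Admissible a 0 0 d p q m)
    (hpos : 0 < a ∧ 0 < d ∧ 0 < p) :
    Routes (dmEdges m) (k4Mult a 0 0 d p q) id := by
  obtain ⟨h0, h1, h2, h3, h4, h5, h6, h7, h8, h9, h10⟩ := h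
  by_contra hn
  have t1 : ¬ _ := fun hf => hn (routes_of_walks (w₀₂ := [0, 2]) (w₀₃ := [0, 2, 3]) (w₁₂ := [1, 3, 2])
    (w₁₃ := [1, 3]) (w₂₃ := [2, 3]) 2 0 0 2 3 0 (by simp [IsWalk]) (by decide) hf)
  have t2 : ¬ _ := fun hf => hn (routes_of_walks (w₀₂ := [0, 2]) (w₀₃ := [0, 1, 3]) (w₁₂ := [1, 3, 2])
    (w₁₃ := [1, 3]) (w₂₃ := [2, 3]) 1 0 0 3 2 1 (by simp [IsWalk]) (by decide) hf)
  have t3 : ¬ _ := fun hf => hn (routes_of_walks (w₀₂ := [0, 2]) (w₀₃ := [0, 2, 3]) (w₁₂ := [1, 0, 2])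
    (w₁₃ := [1, 3]) (w₂₃ := [2, 3]) 3 0 0 1 2 1 (by simp [IsWalk]) (by decide) hf)
  have t4 : ¬ _ := fun hf => hn (routes_of_walks (w₀₂ := [0, 2]) (w₀₃ := [0, 1, 3]) (w₁₂ := [1, 0, 2])
    (w₁₃ := [1, 3]) (w₂₃ := [2, 3]) 2 0 0 2 1 2 (by simp [IsWalk]) (by decide) hf)
  clear hn
  omega

lemma Admissible.routes_support_ad {a d q m : ℕ} (h : Admissible a 0 0 d 0 q m) :
    Routes (dmEdges m) (k4Mult a 0 0 d 0 q) id := by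
  obtain ⟨h0, h1, h2, h3, h4, h5, h6, h7, h8, h9, h10⟩ := h
  by_contra hn
  have t1 : ¬ _ := fun hf => hn (routes_of_walks (w₀₂ := [0, 2]) (w₀₃ := [0, 1, 3]) (w₁₂ := [1, 0, 2])
    (w₁₃ := [1, 3]) (w₂₃ := [2, 0, 1, 3]) 3 0 0 3 0 3 (by simp [IsWalk]) (by decide) hf)
  clear hn
  omega

lemma Admissible.routes_support_ap {a p q m : ℕ} (h : Admissible a 0 0 0 p q m) :
    Routes (dmEdges m) (k4Mult a 0 0 0 p q) id := by
  obtain ⟨h0, h1, h2, h3, h4, h5, h6, h7, h8, h9, h10⟩ := h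
  by_contra hn
  have t1 : ¬ _ := fun hf => hn (routes_of_walks (w₀₂ := [0, 2]) (w₀₃ := [0, 2, 3]) (w₁₂ := [1, 0, 2])
    (w₁₃ := [1, 0, 2, 3]) (w₂₃ := [2, 3]) 4 0 0 0 3 2 (by simp [IsWalk]) (by decide) hf)
  clear hn
  omega

theorem Admissible.routes {a b c d p q m : ℕ} (h : Admissible a b c d p q m) :
    Routes (dmEdges m) (k4Mult a b c d p q) id := by
  have hs := h.swap_roots
  have ho := h.swap_others
  have hso := h.swap_roots.swap_others
  have h₂ := h.deg₂
  have h₃ := h.deg₃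
  have h₂₃ := h.cut₂₃
  rcases Nat.eq_zero_or_pos a with rfl | ha
  · rcases Nat.eq_zero_or_pos b with rfl | hb
    · rcases Nat.eq_zero_or_pos c with rfl | hc
      · rcases Nat.eq_zero_or_pos d with rfl | hd
        · omega
        · rcases Nat.eq_zero_or_pos p with rfl | hp
          · omega
          · exact hso.routes_support_ap.swap_others.swap_roots
      · rcases Nat.eq_zero_or_pos d with rfl | hd
        · rcases Nat.eq_zero_or_pos p with rfl | hp
          · omega
          · exact hs.routes_support_ap.swap_roots
        · rcases Nat.eq_zero_or_pos p with rfl | hp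
          · exact hs.routes_support_ab.swap_roots
          · exact (hs.routes_support_abp ⟨hc, hd, hp⟩).swap_roots
    · rcases Nat.eq_zero_or_pos c with rfl | hc
      · rcases Nat.eq_zero_or_pos d with rfl | hd
        · rcases Nat.eq_zero_or_pos p with rfl | hp
          · omega
          · exact ho.routes_support_ap.swap_others
        · rcases Nat.eq_zero_or_pos p with rfl | hp
          · omega
          · exact (ho.routes_support_acp ⟨hb, hd, hp⟩).swap_others
      · rcases Nat.eq_zero_or_pos d with rfl | hd
        · rcases Nat.eq_zero_or_pos p with rfl | hp
          · exact hs.routes_support_ad.swap_roots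
          · exact (hs.routes_support_adp ⟨hc, hb, hp⟩).swap_roots
        · rcases Nat.eq_zero_or_pos p with rfl | hp
          · exact (hso.routes_support_abc ⟨hd, hc, hb⟩).swap_others.swap_roots
          · exact (hso.routes_support_abcp ⟨hd, hc, hb, hp⟩).swap_others.swap_roots
  · rcases Nat.eq_zero_or_pos b with rfl | hb
    · rcases Nat.eq_zero_or_pos c with rfl | hc
      · rcases Nat.eq_zero_or_pos d with rfl | hd
        · rcases Nat.eq_zero_or_pos p with rfl | hp
          · omega
          · exact h.routes_support_ap
        · rcases Nat.eq_zero_or_pos p with rfl | hp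
          · exact h.routes_support_ad
          · exact h.routes_support_adp ⟨ha, hd, hp⟩
      · rcases Nat.eq_zero_or_pos d with rfl | hd
        · rcases Nat.eq_zero_or_pos p with rfl | hp
          · omega
          · exact h.routes_support_acp ⟨ha, hc, hp⟩
        · rcases Nat.eq_zero_or_pos p with rfl | hp
          · exact (hs.routes_support_abc ⟨hc, hd, ha⟩).swap_roots
          · exact (hs.routes_support_abcp ⟨hc, hd, ha, hp⟩).swap_roots
    · rcases Nat.eq_zero_or_pos c with rfl | hc
      · rcases Nat.eq_zero_or_pos d with rfl | hd
        · rcases Nat.eq_zero_or_pos p with rfl | hp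
          · exact h.routes_support_ab
          · exact h.routes_support_abp ⟨ha, hb, hp⟩
        · rcases Nat.eq_zero_or_pos p with rfl | hp
          · exact (ho.routes_support_abc ⟨hb, ha, hd⟩).swap_others
          · exact (ho.routes_support_abcp ⟨hb, ha, hd, hp⟩).swap_others
      · rcases Nat.eq_zero_or_pos d with rfl | hd
        · rcases Nat.eq_zero_or_pos p with rfl | hp
          · exact h.routes_support_abc ⟨ha, hb, hc⟩
          · exact h.routes_support_abcp ⟨ha, hb, hc, hp⟩
        · rcases Nat.eq_zero_or_pos p with rfl | hp
          · exact h.routes_support_abcd ⟨ha, hb, hc, hd⟩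
          · exact h.routes_support_abcdp ⟨ha, hb, hc, hd, hp⟩

/-- The edge `e` has exactly one end in `X`. -/
def Crosses {α : Type} (X : Finset α) (e : Sym2 α) : Prop := ∃ u v, e = s(u, v) ∧ u ∈ X ∧ v ∉ X

lemma crosses_mk {α : Type} (X : Finset α) (u v : α) :
    Crosses X s(u, v) ↔ ¬ (u ∈ X ↔ v ∈ X) := by
  constructor
  · rintro ⟨u', v', h, hu, hv⟩
    rcases Sym2.eq_iff.1 h with ⟨rfl, rfl⟩ | ⟨rfl, rfl⟩ <;> tauto
  · intro h
    by_cases hu : u ∈ X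
    · exact ⟨u, v, rfl, hu, by tauto⟩
    · exact ⟨v, u, Sym2.eq_swap, by tauto, hu⟩

lemma IsWalk.countP_crosses {α : Type} (X : Finset α) {l : List α} {u v : α}
    (h : IsWalk l u v) :
    (walkEdges l).countP (Crosses X) % 2 = if Crosses X s(u, v) then 1 else 0 := by
  induction l generalizing u with
  | nil => simp [IsWalk] at h
  | cons w l ih =>
    obtain ⟨h1, h2⟩ := h
    obtain rfl : w = u := by simpa using h1
    cases l with
    | nil =>
      obtain rfl : w = v := by simpa using h2
      simp [walkEdges, crosses_mk]
    | cons w' l =>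
      have ih := ih (u := w') ⟨rfl, by simpa using h2⟩
      have e : walkEdges (w :: w' :: l) = s(w, w') ::ₘ walkEdges (w' :: l) := rfl
      rw [e, Multiset.countP_cons]
      simp only [crosses_mk] at ih ⊢
      by_cases a1 : w ∈ X <;> by_cases a2 : w' ∈ X <;> by_cases a3 : v ∈ X <;>
        simp [a1, a2, a3] at ih ⊢ <;> omega

section Routing

variable {α β : Type} {φ : α → β} {P : Multiset (Sym2 α × List β)}

lemma countP_crosses_le (X : Finset β)
    (hP : ∀ p ∈ P, ∃ u v : α, p.1 = s(u, v) ∧ IsWalk p.2 (φ u) (φ v)) :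
    (P.map Prod.fst).countP (fun e => Crosses X (e.map φ)) ≤
      (P.map fun p => walkEdges p.2).sum.countP (Crosses X) := by
  induction P using Multiset.induction with
  | empty => simp
  | cons p P ih =>
    have ih := ih fun p' hp' => hP p' (Multiset.mem_cons_of_mem hp')
    obtain ⟨u, v, h1, h2⟩ := hP p (Multiset.mem_cons_self _ _)
    have h3 := h2.countP_crosses X
    rw [Multiset.map_cons, Multiset.map_cons, Multiset.sum_cons, Multiset.countP_cons,
      Multiset.countP_add, h1, Sym2.map_mk]
    by_cases hc : Crosses X s(φ u, φ v)
    · rw [if_pos hc] at h3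
      rw [if_pos hc]
      omega
    · rw [if_neg hc]
      omega

/-- When the cut `X` has at most one edge to spare, every walk of a routing crosses it as few times
as possible. -/
lemma countP_crosses_eq {E : Multiset (Sym2 β)} (X : Finset β)
    (hP : ∀ p ∈ P, ∃ u v : α, p.1 = s(u, v) ∧ IsWalk p.2 (φ u) (φ v))
    (hE : (P.map fun p => walkEdges p.2).sum ≤ E)
    (hX : E.countP (Crosses X) ≤
      (P.map Prod.fst).countP (fun e => Crosses X (e.map φ)) + 1)
    {p : Sym2 α × List β} (hp : p ∈ P) :
    (walkEdges p.2).countP (Crosses X) = if Crosses X (p.1.map φ) then 1 else 0 := by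
  obtain ⟨P', rfl⟩ := Multiset.exists_cons_of_mem hp
  have h1 := countP_crosses_le X fun p' hp' => hP p' (Multiset.mem_cons_of_mem hp')
  obtain ⟨u, v, h2, h3⟩ := hP p hp
  have h4 := h3.countP_crosses X
  have h5 := Multiset.countP_le_of_le (Crosses X) hE
  rw [Multiset.map_cons, Multiset.sum_cons, Multiset.countP_add] at h5
  rw [Multiset.map_cons, Multiset.countP_cons] at hX
  rw [h2, Sym2.map_mk] at hX ⊢
  by_cases hc : Crosses X s(φ u, φ v)
  · rw [if_pos hc] at h4 hX ⊢
    omega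
  · rw [if_neg hc] at h4 hX ⊢
    omega

end Routing

lemma Routes.exists_mem_of_degrees {m : ℕ} {E : Multiset (Sym2 (Fin 4))}
    (h : Routes (dmEdges m) E id) {u v w w' : Fin 4} (huv : s(u, v) ∈ dmEdges m)
    (hne : u ≠ v ∧ u ≠ w ∧ u ≠ w' ∧ v ≠ w ∧ v ≠ w' ∧ w ≠ w')
    (hw : E.countP (Crosses {w}) ≤ (dmEdges m).countP (Crosses {w}) + 1)
    (hw' : E.countP (Crosses {w'}) ≤ (dmEdges m).countP (Crosses {w'}) + 1)
    (hE : ∀ e ∈ E, ¬ e.IsDiag) : s(u, v) ∈ E := by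
  obtain ⟨P, h1, h2, h3⟩ := h
  obtain ⟨p, hp, hpe⟩ : ∃ p ∈ P, p.1 = s(u, v) := by
    rw [← h1] at huv
    simpa using huv
  have key : ∀ z, E.countP (Crosses {z}) ≤ (dmEdges m).countP (Crosses {z}) + 1 → u ≠ z →
      v ≠ z → ∀ e ∈ walkEdges p.2, ¬ Crosses {z} e := by
    intro z hz hu hv
    have := countP_crosses_eq {z} h2 h3 (by simpa [h1] using hz) hp
    rw [hpe] at this
    simpa [crosses_mk, hu, hv, Multiset.countP_eq_zero] using this
  have hmem : ∀ e ∈ walkEdges p.2, e ∈ E := fun e he =>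
    Multiset.mem_of_le h3 (Multiset.mem_of_le
      (Multiset.single_le_sum (fun _ _ => Multiset.zero_le _) _
        (Multiset.mem_map_of_mem (fun p => walkEdges p.2) hp)) he)
  obtain ⟨e, he, hce⟩ : ∃ e ∈ walkEdges p.2, Crosses {u} e := by
    obtain ⟨u', v', h4, h5⟩ := h2 p hp
    have h6 := h5.countP_crosses {u}
    have h7 : s(u', v') = s(u, v) := h4.symm.trans hpe
    simp only [id, h7] at h6
    rw [if_pos (by simp [crosses_mk, hne.1.symm])] at h6
    rw [← Multiset.countP_pos]
    omega
  have k1 := key w hw hne.2.1 hne.2.2.2.1 e he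
  have k2 := key w' hw' hne.2.2.1 hne.2.2.2.2.1 e he
  have k3 := hmem e he
  have k4 := hE e k3
  clear key hmem he
  induction e with | _ s t =>
  simp only [crosses_mk, Finset.mem_singleton, Sym2.mk_isDiag_iff] at hce k1 k2 k4
  have : s(s, t) = s(u, v) := by
    rw [Sym2.eq_iff]
    omega
  rwa [← this]

lemma countP_crosses_k4Mult (X : Finset (Fin 4)) (a b c d p q : ℕ) :
    (k4Mult a b c d p q).countP (Crosses X) =
      (if (0 ∈ X ↔ 2 ∈ X) then 0 else a) + (if (0 ∈ X ↔ 3 ∈ X) then 0 else b) +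
      (if (1 ∈ X ↔ 2 ∈ X) then 0 else c) + (if (1 ∈ X ↔ 3 ∈ X) then 0 else d) +
      (if (2 ∈ X ↔ 3 ∈ X) then 0 else p) + (if (0 ∈ X ↔ 1 ∈ X) then 0 else q) := by
  simp only [k4Mult, Multiset.countP_add]
  have h : ∀ (n : ℕ) (u v : Fin 4), (Multiset.replicate n s(u, v)).countP (Crosses X) =
      if (u ∈ X ↔ v ∈ X) then 0 else n := by
    intro n u v
    rw [Multiset.countP_eq_card_filter]
    by_cases h : Crosses X s(u, v)
    · rw [if_neg ((crosses_mk _ _ _).1 h), Multiset.filter_eq_self.2, Multiset.card_replicate]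
      intro e he
      rwa [Multiset.eq_of_mem_replicate he]
    · rw [if_pos (by simpa [crosses_mk] using h), Multiset.filter_eq_nil.2, Multiset.card_zero]
      intro e he
      rwa [Multiset.eq_of_mem_replicate he]
  simp only [h]

lemma dmEdges_eq_k4Mult (m : ℕ) : dmEdges m = k4Mult 1 1 1 1 1 (m - 2) := by
  rw [dmEdges, k4Mult, add_comm]
  rfl

lemma mem_k4Mult {a b c d p q : ℕ} {e : Sym2 (Fin 4)} :
    e ∈ k4Mult a b c d p q ↔ (((((a ≠ 0 ∧ e = s(0, 2)) ∨ (b ≠ 0 ∧ e = s(0, 3))) ∨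
      (c ≠ 0 ∧ e = s(1, 2))) ∨ (d ≠ 0 ∧ e = s(1, 3))) ∨ (p ≠ 0 ∧ e = s(2, 3))) ∨
      (q ≠ 0 ∧ e = s(0, 1)) := by
  simp only [k4Mult, Multiset.mem_add, Multiset.mem_replicate]

theorem Routes.not_type {a b c d p q m : ℕ} (hm : 2 ≤ m)
    (h : Routes (dmEdges m) (k4Mult a b c d p q) id) :
    m + 1 ≤ b + c + p + q ∧ m + 1 ≤ a + d + p + q ∧
      ¬ (p = 0 ∧ a = c ∧ b = d ∧ 2 ≤ a ∧ 2 ≤ b ∧ a + b + q = m + 1) ∧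
      ¬ (a = 2 ∧ p = 2 ∧ d = 2 ∧ b = 0 ∧ c = 0 ∧ q + 2 = m + 1) ∧
      ¬ (b = 2 ∧ p = 2 ∧ c = 2 ∧ a = 0 ∧ d = 0 ∧ q + 2 = m + 1) := by
  have hcut : ∀ X : Finset (Fin 4),
      (dmEdges m).countP (Crosses X) ≤ (k4Mult a b c d p q).countP (Crosses X) := by
    obtain ⟨P, h1, h2, h3⟩ := h
    intro X
    have := (countP_crosses_le X h2).trans (Multiset.countP_le_of_le _ h3)
    simpa [h1] using this
  have hdiag : ∀ e ∈ k4Mult a b c d p q, ¬ e.IsDiag := by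
    intro e he
    rw [mem_k4Mult] at he
    rcases he with ((((⟨-, rfl⟩ | ⟨-, rfl⟩) | ⟨-, rfl⟩) | ⟨-, rfl⟩) | ⟨-, rfl⟩) | ⟨-, rfl⟩ <;>
      simp
  refine ⟨?_, ?_, ?_, ?_, ?_⟩
  · have := hcut {0, 2}
    simp [dmEdges_eq_k4Mult, countP_crosses_k4Mult] at this
    omega
  · have := hcut {0, 3}
    simp [dmEdges_eq_k4Mult, countP_crosses_k4Mult] at this
    omega
  · rintro ⟨rfl, rfl, rfl, ha, hb, hq⟩
    have := h.exists_mem_of_degrees (u := 2) (v := 3) (w := 0) (w' := 1)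
      (by simp [dmEdges]) (by decide)
      (by simp [dmEdges_eq_k4Mult, countP_crosses_k4Mult]; omega)
      (by simp [dmEdges_eq_k4Mult, countP_crosses_k4Mult]; omega) hdiag
    simp [mem_k4Mult] at this
  · rintro ⟨rfl, rfl, rfl, rfl, rfl, hq⟩
    have := h.exists_mem_of_degrees (u := 0) (v := 3) (w := 1) (w' := 2)
      (by simp [dmEdges]) (by decide)
      (by simp [dmEdges_eq_k4Mult, countP_crosses_k4Mult]; omega)
      (by simp [dmEdges_eq_k4Mult, countP_crosses_k4Mult]) hdiag
    simp [mem_k4Mult] at this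
  · rintro ⟨rfl, rfl, rfl, rfl, rfl, hq⟩
    have := h.exists_mem_of_degrees (u := 0) (v := 2) (w := 1) (w' := 3)
      (by simp [dmEdges]) (by decide)
      (by simp [dmEdges_eq_k4Mult, countP_crosses_k4Mult]; omega)
      (by simp [dmEdges_eq_k4Mult, countP_crosses_k4Mult]) hdiag
    simp [mem_k4Mult] at this

lemma filter_replicate_eq_ite {α : Type} (n : ℕ) (e : α) (r : α → Prop) [DecidablePred r] :
    (Multiset.replicate n e).filter r = .replicate (if r e then n else 0) e := by
  by_cases h : r e
  · rw [if_pos h, Multiset.filter_eq_self]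
    intro x hx
    rwa [Multiset.eq_of_mem_replicate hx]
  · rw [if_neg h, Multiset.replicate_zero, Multiset.filter_eq_nil]
    intro x hx
    rwa [Multiset.eq_of_mem_replicate hx]

lemma filter_k4Mult (r : Sym2 (Fin 4) → Prop) [DecidablePred r] (a b c d p q : ℕ) :
    (k4Mult a b c d p q).filter r =
      k4Mult (if r s(0, 2) then a else 0) (if r s(0, 3) then b else 0)
        (if r s(1, 2) then c else 0) (if r s(1, 3) then d else 0)
        (if r s(2, 3) then p else 0) (if r s(0, 1) then q else 0) := by
  simp only [k4Mult, Multiset.filter_add, filter_replicate_eq_ite]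

lemma count_k4Mult (a b c d p q : ℕ) :
    (k4Mult a b c d p q).count s(0, 2) = a ∧ (k4Mult a b c d p q).count s(0, 3) = b ∧
      (k4Mult a b c d p q).count s(1, 2) = c ∧ (k4Mult a b c d p q).count s(1, 3) = d ∧
      (k4Mult a b c d p q).count s(2, 3) = p ∧ (k4Mult a b c d p q).count s(0, 1) = q := by
  simp [k4Mult, Multiset.count_replicate]

lemma k4Mult_inj {a b c d p q a' b' c' d' p' q' : ℕ} :
    k4Mult a b c d p q = k4Mult a' b' c' d' p' q' ↔
      a = a' ∧ b = b' ∧ c = c' ∧ d = d' ∧ p = p' ∧ q = q' := by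
  constructor
  · intro h
    have h1 := count_k4Mult a b c d p q
    have h2 := count_k4Mult a' b' c' d' p' q'
    rw [h] at h1
    omega
  · rintro ⟨rfl, rfl, rfl, rfl, rfl, rfl⟩
    rfl

lemma exists_eq_k4Mult (E : Multiset (Sym2 (Fin 4))) (hE : ∀ e ∈ E, ¬ e.IsDiag) :
    ∃ a b c d p q, E = k4Mult a b c d p q := by
  refine ⟨E.count s(0, 2), E.count s(0, 3), E.count s(1, 2), E.count s(1, 3), E.count s(2, 3),
    E.count s(0, 1), ?_⟩
  ext e
  have key : ∀ e : Sym2 (Fin 4), e.IsDiag ∨ e = s(0, 2) ∨ e = s(0, 3) ∨ e = s(1, 2) ∨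
      e = s(1, 3) ∨ e = s(2, 3) ∨ e = s(0, 1) := by decide
  obtain ⟨h1, h2, h3, h4, h5, h6⟩ := count_k4Mult (E.count s(0, 2)) (E.count s(0, 3))
    (E.count s(1, 2)) (E.count s(1, 3)) (E.count s(2, 3)) (E.count s(0, 1))
  rcases key e with h | rfl | rfl | rfl | rfl | rfl | rfl
  · rw [Multiset.count_eq_zero_of_notMem fun he => hE e he h, Multiset.count_eq_zero_of_notMem]
    rw [mem_k4Mult]
    rintro (((((⟨-, rfl⟩ | ⟨-, rfl⟩) | ⟨-, rfl⟩) | ⟨-, rfl⟩) | ⟨-, rfl⟩) | ⟨-, rfl⟩) <;>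
      simp at h
  all_goals simp only [*]

/-- `f` identifies `G` with the multigraph on `Fin 4` with the given multiplicities. -/
structure Labelling (G : MG V) (f : Fin 4 → V) (a b c d p q : ℕ) : Prop where
  inj : Function.Injective f
  verts : Finset.univ.image f = G.verts
  edges : G.edges = (k4Mult a b c d p q).map (Sym2.map f)

lemma Labelling.of_injective {G : MG V} {f : Fin 4 → V} (hf : Function.Injective f)
    (hv : ∀ i, f i ∈ G.verts) (hcard : G.verts.card = 4) :
    ∃ a b c d p q, Labelling G f a b c d p q := by
  have himg : Finset.univ.image f = G.verts := by
    apply Finset.eq_of_subset_of_card_le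
    · simpa [Finset.subset_iff] using hv
    · rw [Finset.card_image_of_injective _ hf, hcard]
      simp
  have hg : ∀ v ∈ G.verts, f (Function.invFun f v) = v := by
    intro v hv
    rw [← himg, Finset.mem_image] at hv
    obtain ⟨i, -, rfl⟩ := hv
    rw [Function.leftInverse_invFun hf i]
  have hE : (G.edges.map (Sym2.map (Function.invFun f))).map (Sym2.map f) = G.edges := by
    rw [Multiset.map_map]
    conv_rhs => rw [← Multiset.map_id G.edges]
    refine Multiset.map_congr rfl fun e he => ?_
    have := G.edge_support e he
    induction e with | _ u v =>
    simp only [Sym2.mem_iff, forall_eq_or_imp, forall_eq] at this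
    simp [hg _ this.1, hg _ this.2]
  obtain ⟨a, b, c, d, p, q, h⟩ :=
    exists_eq_k4Mult (G.edges.map (Sym2.map (Function.invFun f))) (by
      intro e he hd
      obtain ⟨e', he', rfl⟩ := Multiset.mem_map.1 he
      have h1 := G.edge_support e' he'
      have h2 := G.loopless e' he'
      induction e' with | _ u v =>
      simp only [Sym2.mem_iff, forall_eq_or_imp, forall_eq] at h1
      simp only [Sym2.map_mk, Sym2.mk_isDiag_iff] at hd h2
      exact h2 (by rw [← hg u h1.1, hd, hg v h1.2]))
  exact ⟨a, b, c, d, p, q, hf, himg, by rw [← h, hE]⟩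

lemma exists_labelling {G : MG V} {x0 x1 : V} (hx0 : x0 ∈ G.verts) (hx1 : x1 ∈ G.verts)
    (hne : x0 ≠ x1) (hcard : G.verts.card = 4) :
    ∃ f : Fin 4 → V, f 0 = x0 ∧ f 1 = x1 ∧ ∃ a b c d p q, Labelling G f a b c d p q := by
  have h : ((G.verts.erase x0).erase x1).card = 2 := by
    rw [Finset.card_erase_of_mem (by simp [hx1, hne.symm]), Finset.card_erase_of_mem hx0, hcard]
  obtain ⟨y0, y1, hy, h⟩ := Finset.card_eq_two.1 h
  have h0 : y0 ∈ (G.verts.erase x0).erase x1 := by simp [h]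
  have h1 : y1 ∈ (G.verts.erase x0).erase x1 := by simp [h]
  simp only [Finset.mem_erase] at h0 h1
  refine ⟨![x0, x1, y0, y1], rfl, rfl, Labelling.of_injective ?_ ?_ hcard⟩
  · intro i j hij
    fin_cases i <;> fin_cases j <;> simp_all
  · intro i
    fin_cases i <;> simp_all

section Labelling

variable {G : MG V} {f : Fin 4 → V} {a b c d p q m : ℕ}

lemma Labelling.dcut_image (h : Labelling G f a b c d p q) (X : Finset (Fin 4)) :
    dcut G (X.image f) = (if (0 ∈ X ↔ 2 ∈ X) then 0 else a) +
      (if (0 ∈ X ↔ 3 ∈ X) then 0 else b) + (if (1 ∈ X ↔ 2 ∈ X) then 0 else c) +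
      (if (1 ∈ X ↔ 3 ∈ X) then 0 else d) + (if (2 ∈ X ↔ 3 ∈ X) then 0 else p) +
      (if (0 ∈ X ↔ 1 ∈ X) then 0 else q) := by
  have hm : ∀ i, f i ∈ X.image f ↔ i ∈ X := fun i => h.inj.mem_finset_image
  have h1 : dcut G (X.image f) = G.edges.countP (Crosses (X.image f)) :=
    (Multiset.countP_eq_card_filter _ _).symm
  rw [h1, h.edges, Multiset.countP_map, ← countP_crosses_k4Mult, Multiset.countP_eq_card_filter]
  congr 1
  refine Multiset.filter_congr fun e _ => ?_
  induction e with | _ u v =>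
  simp only [Sym2.map_mk, crosses_mk, hm]

lemma Labelling.exists_eq_image (h : Labelling G f a b c d p q) {X : Finset V}
    (hX : X ⊆ G.verts) : ∃ Y : Finset (Fin 4), Y.image f = X := by
  rw [← h.verts] at hX
  obtain ⟨Y, -, hY⟩ := Finset.subset_image_iff.1 hX
  exact ⟨Y, hY⟩

lemma Labelling.image_subset (h : Labelling G f a b c d p q) (X : Finset (Fin 4)) :
    X.image f ⊆ G.verts := by
  rw [← h.verts]
  exact Finset.image_subset_image (Finset.subset_univ _)

lemma Labelling.verts_sdiff_image (h : Labelling G f a b c d p q) (X : Finset (Fin 4)) :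
    G.verts \ X.image f = Xᶜ.image f := by
  rw [← h.verts, ← Finset.image_sdiff_of_injOn h.inj.injOn (Finset.subset_univ _),
    Finset.compl_eq_univ_sdiff]

lemma Labelling.hasRootedDmImmersion (h : Labelling G f a b c d p q)
    (hr : Routes (dmEdges m) (k4Mult a b c d p q) id) :
    HasRootedDmImmersion G m (f 0) (f 1) := by
  refine ⟨f, rfl, rfl, h.inj, fun i => ?_, ?_⟩
  · rw [← h.verts]
    exact Finset.mem_image_of_mem f (Finset.mem_univ i)
  · have := hr.map id f f fun _ => rfl
    rwa [← h.edges, Sym2.map_id, Multiset.map_id] at this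

lemma Labelling.routes (h : Labelling G f a b c d p q) (hi : ImmersionVia G (dmEdges m) f) :
    Routes (dmEdges m) (k4Mult a b c d p q) id := by
  have h2 : Routes (dmEdges m) G.edges f := hi.2.2
  have h3 := h2.map id (Function.invFun f) id fun x => (Function.leftInverse_invFun h.inj x).symm
  have h4 : Function.invFun f ∘ f = id := Function.invFun_comp h.inj
  rwa [h.edges, Multiset.map_map, ← Sym2.map_comp, h4, Sym2.map_id, Multiset.map_id,
    Multiset.map_id] at h3

/-- Type `A_m` only depends on the two internal cuts separating the roots. -/
lemma Labelling.typeA_iff (h : Labelling G f a b c d p q) :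
    TypeA G m (f 0) (f 1) ↔ b + c + p + q = m ∨ a + d + p + q = m := by
  constructor
  · rintro ⟨X0, X1, h0, h1, hc0, hc1, n, C, ⟨hsub, hstep, hcut⟩, rfl, rfl⟩
    have hcard : ∀ i : Fin (n + 1), (C i).card = (C 0).card + i ∧ C 0 ⊆ C i := by
      intro i
      induction i using Fin.induction with
      | zero => simp
      | succ i ih =>
        have := Finset.card_sdiff_add_card_eq_card (hstep i).1
        rw [(hstep i).2] at this
        refine ⟨?_, ih.2.trans (hstep i).1⟩
        simp only [Fin.val_castSucc, Fin.val_succ] at ih ⊢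
        omega
    have hlast : ∀ i, C i ⊆ C (Fin.last n) := by
      intro i
      induction i using Fin.reverseInduction with
      | last => rfl
      | cast i ih => exact (hstep i).1.trans ih
    have hn := (hcard (Fin.last n)).1
    have h2 := Finset.card_sdiff_add_card_eq_card (hsub (Fin.last n))
    have h3 : G.verts.card = 4 := by
      rw [← h.verts, Finset.card_image_of_injective _ h.inj]
      simp
    rw [Fin.val_last] at hn
    obtain ⟨i, hi⟩ : ∃ i, (C i).card = 2 := by
      refine ⟨⟨2 - (C 0).card, by omega⟩, ?_⟩
      rw [(hcard _).1]
      simp only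
      omega
    have h4 := (hcard i).2 h0
    have h5 : f 1 ∉ C i := fun h6 => (Finset.mem_sdiff.1 h1).2 (hlast i h6)
    have h6 := hcut i
    obtain ⟨Y, hY⟩ := h.exists_eq_image (hsub i)
    rw [← hY, h.inj.mem_finset_image] at h4 h5
    rw [← hY, Finset.card_image_of_injective _ h.inj] at hi
    have key : ∀ Y : Finset (Fin 4), Y.card = 2 → 0 ∈ Y → 1 ∉ Y → Y = {0, 2} ∨ Y = {0, 3} := by
      decide
    rw [← hY] at h6
    rcases key Y hi h4 h5 with rfl | rfl <;> rw [h.dcut_image] at h6 <;> simp at h6 <;> omega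
  · have key : ∀ X : Finset (Fin 4), X.card = 2 → 0 ∈ X → 1 ∉ X → dcut G (X.image f) = m →
        TypeA G m (f 0) (f 1) := by
      intro X hX h0 h1 hd
      refine ⟨X.image f, Xᶜ.image f, Finset.mem_image_of_mem f h0,
        Finset.mem_image_of_mem f (by simpa using h1), ?_, ?_, 0, fun _ => X.image f,
        ⟨fun _ => h.image_subset X, fun i => i.elim0, fun _ => hd⟩, rfl, h.verts_sdiff_image X⟩
      · rw [Finset.card_image_of_injective _ h.inj, hX]
      · rw [Finset.card_image_of_injective _ h.inj, Finset.card_compl, hX]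
        simp
    rintro (hm | hm)
    · refine key {0, 2} (by decide) (by decide) (by decide) ?_
      rw [h.dcut_image]
      simp
      omega
    · refine key {0, 3} (by decide) (by decide) (by decide) ?_
      rw [h.dcut_image]
      simp
      omega

/-- The cut conditions on `G`, in terms of multiplicities. -/
lemma Labelling.admissible (h : Labelling G f a b c d p q) (hm : 2 ≤ m)
    (hln : LamNGe G (f 0) (f 1) 3) (hlni : LamNiGe G (f 0) (f 1) 4)
    (hls : LamSGe G (f 0) (f 1) m) (hA : ¬ (b + c + p + q = m ∨ a + d + p + q = m))
    (hB : ¬ ((p = 0 ∧ a = c ∧ b = d ∧ 2 ≤ a ∧ 2 ≤ b ∧ a + b + q = m + 1) ∨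
      (a = 2 ∧ p = 2 ∧ d = 2 ∧ b = 0 ∧ c = 0 ∧ q + 2 = m + 1) ∨
      (b = 2 ∧ p = 2 ∧ c = 2 ∧ a = 0 ∧ d = 0 ∧ q + 2 = m + 1))) :
    Admissible a b c d p q m := by
  have hn : ∀ X : Finset (Fin 4), X.Nonempty → X ≠ Finset.univ → (0 ∈ X ↔ 1 ∈ X) →
      3 ≤ dcut G (X.image f) := by
    intro X h1 h2 h3
    refine hln _ (h.image_subset X) (h1.image f) ?_ ?_
    · rw [← h.verts]
      exact fun h4 => h2 (Finset.image_injective h.inj h4)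
    · simpa only [h.inj.mem_finset_image] using h3
  have hs : ∀ X : Finset (Fin 4), 0 ∈ X → 1 ∉ X → m ≤ dcut G (X.image f) := by
    intro X h1 h2
    refine hls _ (h.image_subset X) ?_ ?_ <;> rwa [h.inj.mem_finset_image]
  have h1 := hn {2} (by decide) (by decide) (by decide)
  have h2 := hn {3} (by decide) (by decide) (by decide)
  have h3 : 4 ≤ dcut G (({2, 3} : Finset (Fin 4)).image f) := by
    refine hlni _ (h.image_subset _) ?_ ?_ ?_
    · rw [Finset.card_image_of_injective _ h.inj]
      decide
    · rw [h.verts_sdiff_image, Finset.card_image_of_injective _ h.inj]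
      decide
    · rw [h.inj.mem_finset_image, h.inj.mem_finset_image]
      decide
  have h4 := hs {0} (by decide) (by decide)
  have h5 := hs {0, 2, 3} (by decide) (by decide)
  have h6 := hs {0, 2} (by decide) (by decide)
  have h7 := hs {0, 3} (by decide) (by decide)
  rw [h.dcut_image] at h1 h2 h3 h4 h5 h6 h7
  simp at h1 h2 h3 h4 h5 h6 h7
  constructor <;> omega

end Labelling

/-- The components of a graph on at most two vertices. -/
lemma isComponent_pair {H : MG V} {u v : V} (huv : u ≠ v) (hv : H.verts = {u, v}) (D : Finset V) :
    IsComponent H D ↔ if s(u, v) ∈ H.edges then D = {u, v} else D = {u} ∨ D = {v} := by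
  have hedge : ∀ e ∈ H.edges, e = s(u, v) := by
    intro e he
    have h1 := H.edge_support e he
    have h2 := H.loopless e he
    induction e with | _ x y =>
    simp only [hv, Sym2.mem_iff, forall_eq_or_imp, forall_eq, Finset.mem_insert,
      Finset.mem_singleton, Sym2.mk_isDiag_iff] at h1 h2
    rw [Sym2.eq_iff]
    obtain ⟨rfl | rfl, rfl | rfl⟩ := h1 <;> simp_all
  have hsub : ∀ D : Finset V, D ⊆ {u, v} → D.Nonempty → D = {u} ∨ D = {v} ∨ D = {u, v} := by
    intro D h1 h2
    have : D ∈ ({u, v} : Finset V).powerset := Finset.mem_powerset.2 h1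
    simp [Finset.powerset_insert] at this
    obtain ⟨x, hx⟩ := h2
    rcases this with (rfl | rfl) | rfl | rfl <;> simp at hx ⊢
  have hsing : ∀ w ∈ H.verts, Connected (induce H {w}) := by
    intro w hw x hx y hy
    simp only [induce, Finset.mem_inter, Finset.mem_singleton] at hx hy
    refine ⟨[w], ⟨by simp [hx.2], by simp [hy.2]⟩, by simp [walkEdges], ?_⟩
    simp [induce, hw]
  split_ifs with h
  · constructor
    · rintro ⟨h1, h2, -, h4⟩
      have h5 := h4 _ h
      rcases hsub D (hv ▸ h1) h2 with rfl | rfl | rfl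
      · have := h5 ⟨u, by simp⟩ v (by simp)
        simp [huv.symm] at this
      · have := h5 ⟨v, by simp⟩ u (by simp)
        simp [huv] at this
      · rfl
    · rintro rfl
      refine ⟨hv.ge, by simp, ?_, ?_⟩
      · have h1 : s(u, v) ∈ (induce H {u, v}).edges := by
          simp [induce, h]
        have h2 : ∀ w ∈ ({u, v} : Finset V), w ∈ (induce H {u, v}).verts := by
          simp [induce, hv]
        intro x hx y hy
        have hx' : x ∈ ({u, v} : Finset V) := by simpa [induce, hv] using hx
        have hy' : y ∈ ({u, v} : Finset V) := by simpa [induce, hv] using hy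
        by_cases hxy : x = y
        · subst hxy
          exact ⟨[x], ⟨rfl, rfl⟩, by simp [walkEdges], by simpa using h2 x hx'⟩
        · refine ⟨[x, y], ⟨rfl, rfl⟩, ?_, by simpa using ⟨h2 x hx', h2 y hy'⟩⟩
          have : s(x, y) = s(u, v) := by
            rw [Sym2.eq_iff]
            simp only [Finset.mem_insert, Finset.mem_singleton] at hx' hy'
            rcases hx' with rfl | rfl <;> rcases hy' with rfl | rfl <;> simp_all
          simpa [walkEdges, this] using h1
      · intro e he _ x hx
        rw [← hv]
        exact H.edge_support e he x hx
  · have hnil : H.edges = 0 := by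
      rw [Multiset.eq_zero_iff_forall_notMem]
      intro e he
      exact h (hedge e he ▸ he)
    constructor
    · rintro ⟨h1, h2, h3, -⟩
      rcases hsub D (hv ▸ h1) h2 with rfl | rfl | rfl
      · exact Or.inl rfl
      · exact Or.inr rfl
      · obtain ⟨l, h4, h5, -⟩ := h3 u (by simp [induce, hv]) v (by simp [induce, hv])
        have h6 : walkEdges l = 0 := by simpa [induce, hnil] using h5
        have h7 := h4.countP_crosses {u}
        rw [h6, if_pos (by simp [crosses_mk, huv.symm])] at h7
        simp at h7
    · intro h1
      have h2 : ∀ w ∈ H.verts, IsComponent H {w} := fun w hw =>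
        ⟨by simpa using hw, by simp, hsing w hw, by simp [hnil]⟩
      rcases h1 with rfl | rfl
      · exact h2 _ (by simp [hv])
      · exact h2 _ (by simp [hv])

lemma path_cases {l : List (Fin 4)} {X : Finset (Fin 4)} (hl : l.Nodup) (hw : IsWalk l 0 1)
    (hX : l.toFinset = insert 0 (insert 1 X)) :
    (X = {2} → l = [0, 2, 1]) ∧ (X = {3} → l = [0, 3, 1]) ∧
      (X = {2, 3} → l = [0, 2, 3, 1] ∨ l = [0, 3, 2, 1]) := by
  have hcard : l.length = (insert 0 (insert 1 X)).card := by
    rw [← hX, List.toFinset_card_of_nodup hl]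
  obtain ⟨h1, h2⟩ := hw
  refine ⟨?_, ?_, ?_⟩
  · rintro rfl
    obtain ⟨x, y, z, rfl⟩ := List.length_eq_three.1 (hcard.trans (by decide))
    obtain rfl : x = 0 := by simpa using h1
    obtain rfl : z = 1 := by simpa using h2
    revert y
    decide
  · rintro rfl
    obtain ⟨x, y, z, rfl⟩ := List.length_eq_three.1 (hcard.trans (by decide))
    obtain rfl : x = 0 := by simpa using h1
    obtain rfl : z = 1 := by simpa using h2
    revert y
    decide
  · rintro rfl
    obtain ⟨x, y, z, w, rfl⟩ : ∃ x y z w, l = [x, y, z, w] := by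
      have : l.length = 4 := hcard.trans (by decide)
      match l, this with
      | [x, y, z, w], _ => exact ⟨x, y, z, w, rfl⟩
    obtain rfl : x = 0 := by simpa using h1
    obtain rfl : w = 1 := by simpa using h2
    revert y z
    decide

lemma nsmul_walkEdges (n : ℕ) :
    n • walkEdges [(0 : Fin 4), 2, 1] = k4Mult n 0 n 0 0 0 ∧
    n • walkEdges [(0 : Fin 4), 3, 1] = k4Mult 0 n 0 n 0 0 ∧
    n • walkEdges [(0 : Fin 4), 2, 3, 1] = k4Mult n 0 0 n n 0 ∧
    n • walkEdges [(0 : Fin 4), 3, 2, 1] = k4Mult 0 n n 0 n 0 := by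
  have e2 : walkEdges [(0 : Fin 4), 2, 1] = k4Mult 1 0 1 0 0 0 := by decide
  have e3 : walkEdges [(0 : Fin 4), 3, 1] = k4Mult 0 1 0 1 0 0 := by decide
  have e4 : walkEdges [(0 : Fin 4), 2, 3, 1] = k4Mult 1 0 0 1 1 0 := by decide
  have e5 : walkEdges [(0 : Fin 4), 3, 2, 1] = k4Mult 0 1 1 0 1 0 := by decide
  simp [e2, e3, e4, e5, nsmul_k4Mult]

section Labelling

variable {G : MG V} {f : Fin 4 → V} {a b c d p q m : ℕ}

lemma Labelling.isComponent_iff (h : Labelling G f a b c d p q) (D : Finset V) :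
    IsComponent (deleteVerts G {f 0, f 1}) D ↔
      if p = 0 then D = ({2} : Finset (Fin 4)).image f ∨ D = ({3} : Finset (Fin 4)).image f
      else D = ({2, 3} : Finset (Fin 4)).image f := by
  have h1 : G.verts \ {f 0, f 1} = {f 2, f 3} := by
    have := h.verts_sdiff_image {0, 1}
    rw [show ({0, 1} : Finset (Fin 4))ᶜ = {2, 3} by decide] at this
    simpa [Finset.image_insert] using this
  have h2 : (deleteVerts G {f 0, f 1}).verts = {f 2, f 3} := by
    rw [← h1]
    exact Finset.inter_eq_right.2 Finset.sdiff_subset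
  have h3 : s(f 2, f 3) ∈ (deleteVerts G {f 0, f 1}).edges ↔ p ≠ 0 := by
    have h4 : s(f 2, f 3) ∈ G.edges ↔ s(2, 3) ∈ k4Mult a b c d p q := by
      rw [h.edges, ← Sym2.map_mk, Multiset.mem_map_of_injective (Sym2.map.injective h.inj)]
    simp only [deleteVerts, induce, h1, Multiset.mem_filter, h4, mem_k4Mult]
    simp
  rw [isComponent_pair (h.inj.ne (by decide)) h2]
  simp only [h3]
  by_cases hp : p = 0 <;> simp [hp, Finset.image_insert]

lemma Labelling.lobeEdges_image (h : Labelling G f a b c d p q) (X : Finset (Fin 4)) :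
    lobeEdges G (X.image f) (f 0) (f 1) =
      (k4Mult (if 2 ∈ X then a else 0) (if 3 ∈ X then b else 0) (if 2 ∈ X then c else 0)
        (if 3 ∈ X then d else 0) (if 2 ∈ X ∧ 3 ∈ X then p else 0) 0).map (Sym2.map f) := by
  have hm : ∀ i, f i ∈ X.image f ↔ i ∈ X := fun i => h.inj.mem_finset_image
  have hi : ∀ i j, f i = f j ↔ i = j := fun i j => h.inj.eq_iff
  rw [lobeEdges, h.edges, Multiset.filter_map, filter_k4Mult]
  congr 1
  simp [hi]

lemma Labelling.emult_eq (h : Labelling G f a b c d p q) : emult G (f 0) (f 1) = q := by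
  rw [emult, h.edges, ← Sym2.map_mk,
    Multiset.count_map_eq_count' _ _ (Sym2.map.injective h.inj)]
  exact (count_k4Mult a b c d p q).2.2.2.2.2

/-- A lobe consisting of parallel paths, pulled back along a labelling. -/
lemma Labelling.exists_path (h : Labelling G f a b c d p q) {X : Finset (Fin 4)} {n : ℕ}
    {l : List V} (hl : l.Nodup) (hw : IsWalk l (f 0) (f 1))
    (hX : l.toFinset = insert (f 0) (insert (f 1) (X.image f)))
    (he : lobeEdges G (X.image f) (f 0) (f 1) = n • walkEdges l) :
    ∃ l' : List (Fin 4), l'.Nodup ∧ IsWalk l' 0 1 ∧ l'.toFinset = insert 0 (insert 1 X) ∧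
      k4Mult (if 2 ∈ X then a else 0) (if 3 ∈ X then b else 0) (if 2 ∈ X then c else 0)
        (if 3 ∈ X then d else 0) (if 2 ∈ X ∧ 3 ∈ X then p else 0) 0 = n • walkEdges l' := by
  obtain ⟨l', rfl⟩ : ∃ l', List.map f l' = l := by
    have : ∀ v ∈ l, ∃ i, f i = v := by
      intro v hv
      rw [← List.mem_toFinset, hX, ← Finset.image_insert, ← Finset.image_insert,
        Finset.mem_image] at hv
      obtain ⟨i, -, hi⟩ := hv
      exact ⟨i, hi⟩
    exact (Set.ext_iff.1 (Set.range_list_map f) l).2 this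
  refine ⟨l', List.Nodup.of_map f hl, ?_, ?_, ?_⟩
  · obtain ⟨h1, h2⟩ := hw
    rw [List.head?_map, Option.map_eq_some_iff] at h1
    rw [List.getLast?_map, Option.map_eq_some_iff] at h2
    obtain ⟨i, hi, hi'⟩ := h1
    obtain ⟨j, hj, hj'⟩ := h2
    obtain rfl := h.inj hi'
    obtain rfl := h.inj hj'
    exact ⟨hi, hj⟩
  · ext i
    have := Finset.ext_iff.1 hX (f i)
    rw [← Finset.image_insert, ← Finset.image_insert, h.inj.mem_finset_image] at this
    rw [← this, List.mem_toFinset, List.mem_toFinset, List.mem_map_of_injective h.inj]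
  · rw [h.lobeEdges_image, walkEdges_map, ← Multiset.map_nsmul] at he
    exact Multiset.map_injective (Sym2.map.injective h.inj) he

lemma Labelling.of_typeB (h : Labelling G f a b c d p q) (hB : TypeB G m (f 0) (f 1)) :
    (p = 0 ∧ a = c ∧ b = d ∧ 2 ≤ a ∧ 2 ≤ b ∧ a + b + q = m + 1) ∨
      (a = 2 ∧ p = 2 ∧ d = 2 ∧ b = 0 ∧ c = 0 ∧ q + 2 = m + 1) ∨
      (b = 2 ∧ p = 2 ∧ c = 2 ∧ a = 0 ∧ d = 0 ∧ q + 2 = m + 1) := by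
  obtain ⟨k, C, nL, hinj, hcomp, hlobe, hsum⟩ := hB
  rw [h.emult_eq] at hsum
  simp only [h.isComponent_iff] at hcomp
  have hpath : ∀ (i : Fin k) (X : Finset (Fin 4)), C i = X.image f → 2 ≤ nL i ∧
      (2 ≤ X.card → nL i = 2) ∧ ∃ l' : List (Fin 4), ((X = {2} → l' = [0, 2, 1]) ∧
        (X = {3} → l' = [0, 3, 1]) ∧ (X = {2, 3} → l' = [0, 2, 3, 1] ∨ l' = [0, 3, 2, 1])) ∧
      k4Mult (if 2 ∈ X then a else 0) (if 3 ∈ X then b else 0) (if 2 ∈ X then c else 0)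
        (if 3 ∈ X then d else 0) (if 2 ∈ X ∧ 3 ∈ X then p else 0) 0 =
          nL i • walkEdges l' := by
    intro i X hX
    obtain ⟨h1, l, h2, h3, h4, h5, h6⟩ := hlobe i
    rw [hX] at h4 h5 h6
    rw [Finset.card_image_of_injective _ h.inj] at h5
    obtain ⟨l', h7, h8, h9, h10⟩ := h.exists_path h2 h3 h4 h6
    exact ⟨h1, h5, l', path_cases h7 h8 h9, h10⟩
  by_cases hp : p = 0
  · simp only [if_pos hp] at hcomp
    obtain ⟨i, hi⟩ := (hcomp _).1 (Or.inl rfl)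
    obtain ⟨j, hj⟩ := (hcomp _).1 (Or.inr rfl)
    have hij : i ≠ j := by
      rintro rfl
      have := Finset.image_injective h.inj (hi.symm.trans hj)
      revert this
      decide
    have huniv : (Finset.univ : Finset (Fin k)) = {i, j} := by
      ext t
      have := (hcomp (C t)).2 ⟨t, rfl⟩
      rw [← hi, ← hj, hinj.eq_iff, hinj.eq_iff] at this
      simpa using this
    rw [huniv, Finset.sum_pair hij] at hsum
    obtain ⟨hi1, -, l, ⟨hl, -⟩, hi2⟩ := hpath i _ hi
    obtain ⟨hj1, -, l', ⟨-, hl', -⟩, hj2⟩ := hpath j _ hj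
    rw [hl rfl, (nsmul_walkEdges _).1, k4Mult_inj] at hi2
    rw [hl' rfl, (nsmul_walkEdges _).2.1, k4Mult_inj] at hj2
    simp at hi2 hj2
    omega
  · simp only [if_neg hp] at hcomp
    obtain ⟨i, hi⟩ := (hcomp _).1 rfl
    have huniv : (Finset.univ : Finset (Fin k)) = {i} := by
      ext t
      have := (hcomp (C t)).2 ⟨t, rfl⟩
      rw [← hi, hinj.eq_iff] at this
      simpa using this
    rw [huniv, Finset.sum_singleton] at hsum
    obtain ⟨-, hi1, l, ⟨-, -, hl⟩, hi2⟩ := hpath i _ hi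
    rw [hi1 (by decide)] at hi2 hsum
    rcases hl rfl with rfl | rfl
    · rw [(nsmul_walkEdges _).2.2.1, k4Mult_inj] at hi2
      simp at hi2
      omega
    · rw [(nsmul_walkEdges _).2.2.2, k4Mult_inj] at hi2
      simp at hi2
      omega

lemma Labelling.lobe_path (h : Labelling G f a b c d p q) (X : Finset (Fin 4)) (n : ℕ)
    (l : List (Fin 4)) (hn : 2 ≤ n) (hl : l.Nodup) (hw : IsWalk l 0 1)
    (hX : l.toFinset = insert 0 (insert 1 X)) (hn2 : 2 ≤ X.card → n = 2)
    (he : k4Mult (if 2 ∈ X then a else 0) (if 3 ∈ X then b else 0) (if 2 ∈ X then c else 0)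
        (if 3 ∈ X then d else 0) (if 2 ∈ X ∧ 3 ∈ X then p else 0) 0 = n • walkEdges l) :
    2 ≤ n ∧ ∃ l : List V, l.Nodup ∧ IsWalk l (f 0) (f 1) ∧
      l.toFinset = insert (f 0) (insert (f 1) (X.image f)) ∧ (2 ≤ (X.image f).card → n = 2) ∧
      lobeEdges G (X.image f) (f 0) (f 1) = n • walkEdges l := by
  refine ⟨hn, l.map f, hl.map h.inj, hw.map f, ?_, ?_, ?_⟩
  · rw [← Finset.image_insert, ← Finset.image_insert, ← hX]
    ext v
    simp
  · rwa [Finset.card_image_of_injective _ h.inj]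
  · rw [h.lobeEdges_image, he, Multiset.map_nsmul, walkEdges_map]

lemma Labelling.typeB_of_two_lobes (h : Labelling G f a b c d p q)
    (hB : p = 0 ∧ a = c ∧ b = d ∧ 2 ≤ a ∧ 2 ≤ b ∧ a + b + q = m + 1) :
    TypeB G m (f 0) (f 1) := by
  obtain ⟨rfl, rfl, rfl, ha, hb, hq⟩ := hB
  refine ⟨2, ![({2} : Finset (Fin 4)).image f, ({3} : Finset (Fin 4)).image f], ![a, b], ?_, ?_,
    ?_, ?_⟩
  · intro i j hij
    have h23 : f 2 ≠ f 3 := h.inj.ne (by decide)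
    fin_cases i <;> fin_cases j <;> simp_all
  · intro D
    rw [h.isComponent_iff, if_pos rfl, Fin.exists_fin_two]
    simp only [Matrix.cons_val_zero, Matrix.cons_val_one, eq_comm]
  · rw [Fin.forall_fin_two]
    refine ⟨h.lobe_path {2} a [0, 2, 1] ha (by decide) ⟨rfl, rfl⟩ (by decide) (by simp) ?_,
      h.lobe_path {3} b [0, 3, 1] hb (by decide) ⟨rfl, rfl⟩ (by decide) (by simp) ?_⟩
    · rw [(nsmul_walkEdges _).1, k4Mult_inj]
      simp
    · rw [(nsmul_walkEdges _).2.1, k4Mult_inj]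
      simp
  · rw [h.emult_eq, Fin.sum_univ_two]
    simp only [Matrix.cons_val_zero, Matrix.cons_val_one]
    omega

lemma Labelling.typeB_of_path (h : Labelling G f a b c d p q) (hp : p ≠ 0) (hq : q + 2 = m + 1)
    (l : List (Fin 4)) (hl : l.Nodup) (hw : IsWalk l 0 1)
    (hX : l.toFinset = insert 0 (insert 1 {2, 3}))
    (he : k4Mult a b c d p 0 = 2 • walkEdges l) : TypeB G m (f 0) (f 1) := by
  refine ⟨1, fun _ => ({2, 3} : Finset (Fin 4)).image f, fun _ => 2,
    Function.injective_of_subsingleton _, ?_, fun _ => ?_, ?_⟩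
  · intro D
    rw [h.isComponent_iff, if_neg hp]
    simp only [exists_const, eq_comm]
  · exact h.lobe_path {2, 3} 2 l le_rfl hl hw hX (fun _ => rfl) (by simpa using he)
  · rw [h.emult_eq]
    simpa using hq

lemma Labelling.typeB_iff (h : Labelling G f a b c d p q) :
    TypeB G m (f 0) (f 1) ↔
      (p = 0 ∧ a = c ∧ b = d ∧ 2 ≤ a ∧ 2 ≤ b ∧ a + b + q = m + 1) ∨
      (a = 2 ∧ p = 2 ∧ d = 2 ∧ b = 0 ∧ c = 0 ∧ q + 2 = m + 1) ∨
      (b = 2 ∧ p = 2 ∧ c = 2 ∧ a = 0 ∧ d = 0 ∧ q + 2 = m + 1) := by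
  refine ⟨h.of_typeB, ?_⟩
  rintro (hB | ⟨rfl, rfl, rfl, rfl, rfl, hq⟩ | ⟨rfl, rfl, rfl, rfl, rfl, hq⟩)
  · exact h.typeB_of_two_lobes hB
  · exact h.typeB_of_path (by decide) hq [0, 2, 3, 1] (by decide) ⟨rfl, rfl⟩ (by decide)
      (nsmul_walkEdges 2).2.2.1.symm
  · exact h.typeB_of_path (by decide) hq [0, 3, 2, 1] (by decide) ⟨rfl, rfl⟩ (by decide)
      (nsmul_walkEdges 2).2.2.2.symm

end Labelling

/-- Let `m ≥ 2` and let `G` be a rooted graph with roots `x0, x1`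
such that `|V(G)| = 4`, `λ_n(G) ≥ 3`, `λ_n^i(G) ≥ 4`, and `λ_s(G) ≥ m`.  Then `G`
has no rooted immersion of `D_m` if and only if `G` has type `A_m` or type `B_m`. -/
theorem statement_3 {V : Type} (G : MG V) (x0 x1 : V) (m : ℕ)
    (hm : 2 ≤ m) (hconn : Connected G)
    (hx0 : x0 ∈ G.verts) (hx1 : x1 ∈ G.verts) (hne : x0 ≠ x1)
    (hcard : G.verts.card = 4)
    (hln : LamNGe G x0 x1 3) (hlni : LamNiGe G x0 x1 4) (hls : LamSGe G x0 x1 m) :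
    ¬ HasRootedDmImmersion G m x0 x1 ↔ (TypeA G m x0 x1 ∨ TypeB G m x0 x1) := by
  constructor
  · intro hno
    obtain ⟨f, rfl, rfl, a, b, c, d, p, q, h⟩ := exists_labelling hx0 hx1 hne hcard
    rw [h.typeA_iff, h.typeB_iff]
    by_contra hAB
    rw [not_or] at hAB
    exact hno (h.hasRootedDmImmersion (h.admissible hm hln hlni hls hAB.1 hAB.2).routes)
  · rintro hAB ⟨f, rfl, rfl, hf⟩
    obtain ⟨a, b, c, d, p, q, h⟩ := Labelling.of_injective hf.1 hf.2.1 hcard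
    have := (h.routes hf).not_type hm
    rw [h.typeA_iff, h.typeB_iff] at hAB
    omega

end PaperW4
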